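/- arXiv:1811.12083 — 2 statements merged into one kernel-verified Lean document; each statement's English description precedes it below -/
import Mathlib

section
/- Let 𝒜 = {A₁,…,A_n} be a finite set of arguments, let 𝒞 = {∑_{i=1}^n c⁽ʲ⁾_i·π(A_i) ≤ c⁽ʲ⁾₀ : 1 ≤ j ≤ m} be a satisfiable finite set of linear atomic constraints, and let 1 ≤ k ≤ n. Then the set {P(A_k) : P a probability function over 𝒜 satisfying 𝒞} equals the set {x_k : x ∈ [0,1]^n with ∑_{i=1}^n c⁽ʲ⁾_i·x_i ≤ c⁽ʲ⁾₀ for all j}. In particular, both sets have the same minimum and the same maximum, and these extrema are attained. -/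
open Finset

/-- A probability function over a finite set of arguments. -/
def IsProbFun {α : Type*} [Fintype α] [DecidableEq α] (P : Finset α → ℝ) : Prop :=
  (∀ w, 0 ≤ P w ∧ P w ≤ 1) ∧ ∑ w : Finset α, P w = 1

/-- The probability of an argument under a probability function. -/
def argProb {α : Type*} [Fintype α] [DecidableEq α] (P : Finset α → ℝ) (a : α) : ℝ :=
  ∑ w ∈ univ.filter (fun w : Finset α => a ∈ w), P w

/-- The probability function under which the arguments are independent with marginals `y`. -/
noncomputable def indepProb {α : Type*} [Fintype α] [DecidableEq α] (y : α → ℝ)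
    (w : Finset α) : ℝ :=
  (∏ a ∈ w, y a) * ∏ a ∈ univ \ w, (1 - y a)

theorem isProbFun_of_nonneg_of_sum_eq_one {α : Type*} [Fintype α] [DecidableEq α]
    {P : Finset α → ℝ} (h0 : ∀ w, 0 ≤ P w) (h1 : ∑ w, P w = 1) : IsProbFun P :=
  ⟨fun w => ⟨h0 w, h1 ▸ single_le_sum (fun v _ => h0 v) (mem_univ w)⟩, h1⟩

theorem isProbFun_indepProb {α : Type*} [Fintype α] [DecidableEq α] {y : α → ℝ}
    (hy : ∀ a, 0 ≤ y a ∧ y a ≤ 1) : IsProbFun (indepProb y) := by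
  refine isProbFun_of_nonneg_of_sum_eq_one (fun w => ?_) ?_
  · exact mul_nonneg (prod_nonneg fun a _ => (hy a).1)
      (prod_nonneg fun a _ => sub_nonneg.2 (hy a).2)
  · have h := prod_add y (fun a => 1 - y a) univ
    simpa [indepProb] using h.symm

theorem argProb_indepProb {α : Type*} [Fintype α] [DecidableEq α] (y : α → ℝ) (a : α) :
    argProb (indepProb y) a = y a := by
  have h := prod_add y (Function.update (fun b => 1 - y b) a 0) univ
  rw [powerset_univ] at h
  have hl : ∏ b, (y b + Function.update (fun b => 1 - y b) a 0 b) = y a := by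
    rw [prod_eq_single a]
    · simp
    · intro b _ hb
      simp [hb]
    · simp
  rw [argProb, sum_filter, ← hl, h]
  refine sum_congr rfl fun w _ => ?_
  split_ifs with haw
  · rw [indepProb]
    congr 1
    refine prod_congr rfl fun b hb => ?_
    have hba : b ≠ a := by
      rintro rfl
      simp [haw] at hb
    simp [hba]
  · rw [prod_eq_zero (s := univ \ w) (i := a) (by simp [haw]) (by simp), mul_zero]

theorem argProb_mem_unitInterval {α : Type*} [Fintype α] [DecidableEq α] {P : Finset α → ℝ}
    (hP : IsProbFun P) (a : α) : 0 ≤ argProb P a ∧ argProb P a ≤ 1 := by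
  refine ⟨sum_nonneg fun w _ => (hP.1 w).1, hP.2 ▸ ?_⟩
  exact sum_le_sum_of_subset_of_nonneg (filter_subset _ _) fun w _ _ => (hP.1 w).1

theorem isCompact_unitCube_inter_halfSpaces {n m : ℕ} (c : Fin m → Fin n → ℝ)
    (c₀ : Fin m → ℝ) :
    IsCompact {x : Fin n → ℝ | (∀ i, 0 ≤ x i ∧ x i ≤ 1) ∧ ∀ j, ∑ i, c j i * x i ≤ c₀ j} := by
  have hbox : {x : Fin n → ℝ | ∀ i, 0 ≤ x i ∧ x i ≤ 1} = Set.Icc 0 1 := by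
    ext x
    simp [Pi.le_def, forall_and]
  have hclosed : IsClosed {x : Fin n → ℝ | ∀ j, ∑ i, c j i * x i ≤ c₀ j} := by
    simp only [Set.ofPred_forall]
    exact isClosed_iInter fun j => isClosed_le (by fun_prop) continuous_const
  have h := (isCompact_Icc (a := (0 : Fin n → ℝ)) (b := 1)).inter_right hclosed
  rwa [← hbox] at h

/-- For a satisfiable set `𝒞` of linear atomic constraints over `𝒜 = {A₁,…,Aₙ}` and any
index `k`, the set of probabilities `{P(A_k) : P ⊨ 𝒞}` equals the set
`{x_k : x ∈ [0,1]ⁿ, x ⊨ 𝒞}`; in particular both sets have the same attained minimum and the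
same attained maximum. -/
theorem stmt6 {α : Type*} [Fintype α] [DecidableEq α] (n m : ℕ)
    (A : Fin n → α) (hA : Function.Bijective A)
    (c : Fin m → Fin n → ℝ) (c₀ : Fin m → ℝ)
    (hsat : ∃ P : Finset α → ℝ, IsProbFun P ∧
      ∀ j : Fin m, ∑ i, c j i * argProb P (A i) ≤ c₀ j)
    (k : Fin n) :
    ({p : ℝ | ∃ P : Finset α → ℝ, IsProbFun P ∧
        (∀ j : Fin m, ∑ i, c j i * argProb P (A i) ≤ c₀ j) ∧ argProb P (A k) = p} =
     {p : ℝ | ∃ x : Fin n → ℝ, (∀ i, 0 ≤ x i ∧ x i ≤ 1) ∧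
        (∀ j : Fin m, ∑ i, c j i * x i ≤ c₀ j) ∧ x k = p}) ∧
    (∃ lo ∈ {p : ℝ | ∃ P : Finset α → ℝ, IsProbFun P ∧
        (∀ j : Fin m, ∑ i, c j i * argProb P (A i) ≤ c₀ j) ∧ argProb P (A k) = p},
      ∀ p ∈ {p : ℝ | ∃ P : Finset α → ℝ, IsProbFun P ∧
        (∀ j : Fin m, ∑ i, c j i * argProb P (A i) ≤ c₀ j) ∧ argProb P (A k) = p}, lo ≤ p) ∧
    (∃ hi ∈ {p : ℝ | ∃ P : Finset α → ℝ, IsProbFun P ∧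
        (∀ j : Fin m, ∑ i, c j i * argProb P (A i) ≤ c₀ j) ∧ argProb P (A k) = p},
      ∀ p ∈ {p : ℝ | ∃ P : Finset α → ℝ, IsProbFun P ∧
        (∀ j : Fin m, ∑ i, c j i * argProb P (A i) ≤ c₀ j) ∧ argProb P (A k) = p}, p ≤ hi) := by
  have heq : {p : ℝ | ∃ P : Finset α → ℝ, IsProbFun P ∧
        (∀ j : Fin m, ∑ i, c j i * argProb P (A i) ≤ c₀ j) ∧ argProb P (A k) = p} =
      {p : ℝ | ∃ x : Fin n → ℝ, (∀ i, 0 ≤ x i ∧ x i ≤ 1) ∧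
        (∀ j : Fin m, ∑ i, c j i * x i ≤ c₀ j) ∧ x k = p} := by
    ext p
    constructor
    · rintro ⟨P, hP, hc, rfl⟩
      exact ⟨fun i => argProb P (A i), fun i => argProb_mem_unitInterval hP (A i), hc, rfl⟩
    · rintro ⟨x, hx, hc, rfl⟩
      let e := Equiv.ofBijective A hA
      have hmarg : ∀ i, argProb (indepProb (x ∘ e.symm)) (A i) = x i := fun i => by
        rw [argProb_indepProb]
        exact congrArg x (e.symm_apply_apply i)
      refine ⟨indepProb (x ∘ e.symm), isProbFun_indepProb fun a => hx (e.symm a), ?_, hmarg k⟩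
      simpa only [hmarg] using hc
  refine ⟨heq, ?_⟩
  obtain ⟨P, hP, hPc⟩ := hsat
  have hK := isCompact_unitCube_inter_halfSpaces c c₀
  have hne : {x : Fin n → ℝ | (∀ i, 0 ≤ x i ∧ x i ≤ 1) ∧
      ∀ j, ∑ i, c j i * x i ≤ c₀ j}.Nonempty :=
    ⟨fun i => argProb P (A i), fun i => argProb_mem_unitInterval hP (A i), hPc⟩
  rw [heq]
  constructor
  · obtain ⟨x, ⟨hx, hxc⟩, hmin⟩ := hK.exists_isMinOn hne (continuous_apply k).continuousOn
    refine ⟨x k, ⟨x, hx, hxc, rfl⟩, ?_⟩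
    rintro _ ⟨y, hy, hyc, rfl⟩
    exact hmin ⟨hy, hyc⟩
  · obtain ⟨x, ⟨hx, hxc⟩, hmax⟩ := hK.exists_isMaxOn hne (continuous_apply k).continuousOn
    refine ⟨x k, ⟨x, hx, hxc, rfl⟩, ?_⟩
    rintro _ ⟨y, hy, hyc, rfl⟩
    exact hmax ⟨hy, hyc⟩
end

section
/- Let 𝒜 be a finite set of arguments, let L : 𝒜 → [0,1] be a probability labelling with associated product probability function P_L(w) = ∏_{A ∈ w} L(A) · ∏_{A ∈ 𝒜 \ w} (1 − L(A)), and let A, B, C ∈ 𝒜 be distinct arguments such that P_L(C) ≤ 1 − P_L(A) (coherence for the attack (A,C)) and P_L(C) ≥ P_L(B) (support-coherence for the support (B,C)). Then: (1) P_L(A) + P_L(B) ≤ 1; (2) for every conjunction χ of arguments from 𝒜, P_L(A ∧ ¬B ∧ C ∧ χ) ≤ min{0.25, 1 − P_L(A)}; and (3) for every conjunction χ of arguments from 𝒜, P_L(¬A ∧ B ∧ ¬C ∧ χ) ≤ min{0.25, 1 − P_L(B)}. -/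
open Finset

/-- The product probability function `P_L` associated with a probability labelling `L`. -/
def prodFun {α : Type*} [Fintype α] [DecidableEq α] (L : α → ℝ) (w : Finset α) : ℝ :=
  (∏ a ∈ w, L a) * ∏ a ∈ wᶜ, (1 - L a)

/-- The probability of an event under a probability function. -/
def eventProb {α : Type*} [Fintype α] [DecidableEq α] (P : Finset α → ℝ)
    (E : Finset α → Prop) [DecidablePred E] : ℝ :=
  ∑ w ∈ univ.filter E, P w

lemma prodFun_nonneg {α : Type*} [Fintype α] [DecidableEq α] {L : α → ℝ}
    (hL : ∀ a, 0 ≤ L a ∧ L a ≤ 1) (w : Finset α) : 0 ≤ prodFun L w :=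
  mul_nonneg (prod_nonneg fun a _ => (hL a).1)
    (prod_nonneg fun a _ => sub_nonneg.2 (hL a).2)

lemma eventProb_mono {α : Type*} [Fintype α] [DecidableEq α] {P : Finset α → ℝ}
    (hP : ∀ w, 0 ≤ P w) {E F : Finset α → Prop} [DecidablePred E] [DecidablePred F]
    (h : ∀ w, E w → F w) : eventProb P E ≤ eventProb P F :=
  sum_le_sum_of_subset_of_nonneg (monotone_filter_right _ fun w _ => h w) fun w _ _ => hP w

/-- Under the product probability function, literals on distinct arguments are independent. -/
lemma eventProb_prodFun_subset_disjoint {α : Type*} [Fintype α] [DecidableEq α] (L : α → ℝ)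
    {U V : Finset α} (hUV : Disjoint U V) :
    eventProb (prodFun L) (fun w => U ⊆ w ∧ Disjoint V w)
      = (∏ a ∈ U, L a) * ∏ a ∈ V, (1 - L a) := by
  have hsum := prod_add (fun a => if a ∈ V then 0 else L a)
    (fun a => if a ∈ U then 0 else 1 - L a) univ
  have hfactor : ∀ a, ((if a ∈ V then 0 else L a) + if a ∈ U then 0 else 1 - L a)
      = (if a ∈ U then L a else 1) * if a ∈ V then 1 - L a else 1 := by
    intro a
    by_cases hU : a ∈ U
    · simp [hU, disjoint_left.1 hUV hU]
    · by_cases hV : a ∈ V <;> simp [hU, hV]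
  simp only [hfactor, prod_mul_distrib, prod_ite_mem, univ_inter] at hsum
  rw [hsum, eventProb, sum_filter, powerset_univ]
  refine sum_congr rfl fun w _ => ?_
  rw [← compl_eq_univ_sdiff]
  split_ifs with hw
  · refine congrArg₂ (· * ·) (prod_congr rfl fun a ha => ?_) (prod_congr rfl fun a ha => ?_)
    · rw [if_neg (disjoint_right.1 hw.2 ha)]
    · rw [if_neg fun h => mem_compl.1 ha (hw.1 h)]
  · rw [not_and_or, not_subset, not_disjoint_iff] at hw
    obtain ⟨a, hU, ha⟩ | ⟨a, hV, ha⟩ := hw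
    · exact (mul_eq_zero_of_right _ (prod_eq_zero (mem_compl.2 ha) (by simp [hU]))).symm
    · exact (mul_eq_zero_of_left (prod_eq_zero ha (by simp [hV])) _).symm

lemma argProb_prodFun {α : Type*} [Fintype α] [DecidableEq α] (L : α → ℝ) (a : α) :
    argProb (prodFun L) a = L a := by
  simpa [eventProb, argProb] using
    eventProb_prodFun_subset_disjoint L (disjoint_empty_right {a})

/-- For distinct arguments `A, B, C` with coherence for the attack `(A,C)` (i.e.
`P_L(C) ≤ 1 − P_L(A)`) and support-coherence for the support `(B,C)` (i.e.
`P_L(C) ≥ P_L(B)`): (1) `P_L(A) + P_L(B) ≤ 1`; (2) for every conjunction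
`χ = ⋀_{a ∈ S} a`, `P_L(A ∧ ¬B ∧ C ∧ χ) ≤ min {0.25, 1 − P_L(A)}`; and (3) for every
conjunction `χ = ⋀_{a ∈ S} a`, `P_L(¬A ∧ B ∧ ¬C ∧ χ) ≤ min {0.25, 1 − P_L(B)}`. -/
theorem stmt14 {α : Type*} [Fintype α] [DecidableEq α]
    (L : α → ℝ) (hL : ∀ a, 0 ≤ L a ∧ L a ≤ 1)
    (A B C : α) (hAB : A ≠ B) (hAC : A ≠ C) (hBC : B ≠ C)
    (hCoh : argProb (prodFun L) C ≤ 1 - argProb (prodFun L) A)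
    (hSCoh : argProb (prodFun L) B ≤ argProb (prodFun L) C) :
    argProb (prodFun L) A + argProb (prodFun L) B ≤ 1 ∧
    (∀ S : Finset α,
      eventProb (prodFun L) (fun w => A ∈ w ∧ B ∉ w ∧ C ∈ w ∧ S ⊆ w)
        ≤ min (0.25 : ℝ) (1 - argProb (prodFun L) A)) ∧
    (∀ S : Finset α,
      eventProb (prodFun L) (fun w => A ∉ w ∧ B ∈ w ∧ C ∉ w ∧ S ⊆ w)
        ≤ min (0.25 : ℝ) (1 - argProb (prodFun L) B)) := by
  simp only [argProb_prodFun] at *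
  have hA := hL A
  have hB := hL B
  have hC := hL C
  refine ⟨by linarith, fun S => ?_, fun S => ?_⟩
  · have hle : eventProb (prodFun L) (fun w => A ∈ w ∧ B ∉ w ∧ C ∈ w ∧ S ⊆ w) ≤ L A * L C := by
      refine (eventProb_mono (prodFun_nonneg hL) (F := fun w => {A, C} ⊆ w ∧ Disjoint ∅ w)
        fun w hw => ?_).trans_eq ?_
      · simp [insert_subset_iff, hw.1, hw.2.2.1]
      · rw [eventProb_prodFun_subset_disjoint L (disjoint_empty_right _), prod_pair hAC,
          prod_empty, mul_one]
    refine hle.trans (le_min ?_ ?_)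
    · norm_num
      nlinarith [sq_nonneg (L A - 1 / 2)]
    · nlinarith
  · have hle : eventProb (prodFun L) (fun w => A ∉ w ∧ B ∈ w ∧ C ∉ w ∧ S ⊆ w)
        ≤ L B * (1 - L C) := by
      refine (eventProb_mono (prodFun_nonneg hL) (F := fun w => {B} ⊆ w ∧ Disjoint {C} w)
        fun w hw => ?_).trans_eq ?_
      · simp [hw.2.1, hw.2.2.1]
      · rw [eventProb_prodFun_subset_disjoint L (disjoint_singleton.2 hBC), prod_singleton,
          prod_singleton]
    refine hle.trans (le_min ?_ ?_)
    · norm_num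
      nlinarith [sq_nonneg (L B - 1 / 2)]
    · nlinarith
end
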